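/- In the two-player game on [0,1]² with payoffs u₁(a₁,a₂) = a₂/8 if a₁ = −1 (extended action set A₁ = {−1} ∪ [0,1]), u₁(a₁,a₂) = a₁ if 0 ≤ a₁ < a₂/2, u₁(a₁,a₂) = a₂ − a₁ if a₂/2 ≤ a₁ ≤ 1, and u₂(a₁,a₂) = −a₂: for any Borel probability measure μ₂ on A₂ = [0,1] and any ε ∈ (0,1/8], if player 2 plays σ₂ = (1−ε)·δ(ε) + ε·μ₂, then every pure best response b₁ of player 1 against σ₂ satisfies 0 ≤ b₁ ≤ 2ε. -/

import Mathlib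

open MeasureTheory

/-- Player 1's payoff in the Simon–Stinchcombe example: `u₁(-1, a₂) = a₂/8`,
`u₁(a₁,a₂) = a₁` for `0 ≤ a₁ < a₂/2`, and `u₁(a₁,a₂) = a₂ - a₁` for `a₂/2 ≤ a₁ ≤ 1`. -/
noncomputable def u18 (a₁ a₂ : ℝ) : ℝ :=
  if a₁ = -1 then a₂ / 8 else if a₁ < a₂ / 2 then a₁ else a₂ - a₁

/-- Player 1's action set `A₁ = {-1} ∪ [0,1]`. -/
def A1 : Set ℝ := {-1} ∪ Set.Icc 0 1

/-- Expected payoff of pure action `b₁` against `σ₂ = (1-ε)·δ(ε) + ε·μ₂`. -/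
noncomputable def payoff18 (ε : ℝ) (μ₂ : Measure ℝ) (b₁ : ℝ) : ℝ :=
  (1 - ε) * u18 b₁ ε + ε * ∫ a₂, u18 b₁ a₂ ∂μ₂

theorem aux_int_le (μ : Measure ℝ) [IsProbabilityMeasure μ] (hs : μ (Set.Icc 0 1) = 1)
    (f : ℝ → ℝ) (c : ℝ) (hc : 0 ≤ c) (h : ∀ x ∈ Set.Icc (0 : ℝ) 1, f x ≤ c) :
    ∫ x, f x ∂μ ≤ c := by
  by_cases hf : Integrable f μ
  · have hae : ∀ᵐ x ∂μ, x ∈ Set.Icc (0 : ℝ) 1 :=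
      (mem_ae_iff_prob_eq_one measurableSet_Icc).2 hs
    have := integral_mono_ae hf (integrable_const c) (hae.mono h)
    simpa using this
  · rw [integral_undef hf]; exact hc

/-- For any Borel probability measure `μ₂` on `[0,1]` and any `ε ∈ (0, 1/8]`, if player 2
plays `(1-ε)·δ(ε) + ε·μ₂`, then every pure best response `b₁` of player 1 satisfies
`0 ≤ b₁ ≤ 2ε`. -/
theorem pure_best_responses_are_small
    (μ₂ : Measure ℝ) (hμ₂ : IsProbabilityMeasure μ₂) (hμsupp : μ₂ (Set.Icc 0 1) = 1)
    (ε : ℝ) (hε : ε ∈ Set.Ioc (0 : ℝ) (1 / 8))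
    (b₁ : ℝ) (hb₁ : b₁ ∈ A1)
    (hBR : ∀ b₁' ∈ A1, payoff18 ε μ₂ b₁' ≤ payoff18 ε μ₂ b₁) :
    0 ≤ b₁ ∧ b₁ ≤ 2 * ε := by
  obtain ⟨h0, h8⟩ := hε
  have hmem : ε / 2 ∈ A1 := Or.inr ⟨by linarith, by linarith⟩
  have hlow := hBR _ hmem
  have hI : ∫ a, -u18 (ε / 2) a ∂μ₂ ≤ ε / 2 := by
    refine aux_int_le μ₂ hμsupp _ _ (by linarith) ?_
    rintro x ⟨hx0, hx1⟩
    unfold u18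
    split_ifs <;> linarith
  rw [integral_neg] at hI
  have hu : u18 (ε / 2) ε = ε / 2 := by
    unfold u18
    rw [if_neg (by linarith), if_neg (by linarith)]; ring
  have hlow2 : 3 * ε / 8 ≤ payoff18 ε μ₂ b₁ := by
    refine le_trans ?_ hlow
    unfold payoff18
    rw [hu]
    nlinarith
  rcases hb₁ with hb | ⟨hb0, hb1⟩
  · exfalso
    have hb : b₁ = -1 := hb
    subst hb
    have hJ : ∫ a, u18 (-1) a ∂μ₂ ≤ 1 / 8 := by
      refine aux_int_le μ₂ hμsupp _ _ (by norm_num) ?_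
      rintro x ⟨hx0, hx1⟩
      simp only [u18, if_true]
      linarith
    have hv : u18 (-1) ε = ε / 8 := by simp [u18]
    unfold payoff18 at hlow2
    rw [hv] at hlow2
    nlinarith
  · refine ⟨hb0, ?_⟩
    by_contra! hgt
    have hJ : ∫ a, u18 b₁ a ∂μ₂ ≤ 1 / 2 := by
      refine aux_int_le μ₂ hμsupp _ _ (by norm_num) ?_
      rintro x ⟨hx0, hx1⟩
      unfold u18
      split_ifs <;> linarith
    have hv : u18 b₁ ε = ε - b₁ := by
      unfold u18
      rw [if_neg (by linarith), if_neg (by linarith)]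
    unfold payoff18 at hlow2
    rw [hv] at hlow2
    nlinarith
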